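/- Scaling property of the inverse divergence: let 1 ≤ p ≤ ∞, f ∈ C^∞(𝕋^d; ℝ^d) with zero spatial mean, and σ ∈ ℕ. Then ‖R(f(σ·))‖_{L^p} ≲ σ^{−1} ‖f‖_{L^p}, where R is the inverse divergence operator on 𝕋^d producing symmetric trace-free matrices with div(Rf) = f. -/

import Mathlib

open MeasureTheory
open scoped BigOperators NNReal ENNReal

noncomputable section

/-- Partial derivative `∂ᵢ f` of a scalar function on `ℝ^d`. -/
noncomputable def pdd (d : ℕ) (i : Fin d) (f : (Fin d → ℝ) → ℝ) (x : Fin d → ℝ) : ℝ :=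
  fderiv ℝ f x (Pi.single i 1)

/-- The Laplacian of a scalar function on `ℝ^d`. -/
noncomputable def lap (d : ℕ) (f : (Fin d → ℝ) → ℝ) (x : Fin d → ℝ) : ℝ :=
  ∑ i, pdd d i (fun y => pdd d i f y) x

/-- `ℤ^d`-periodicity of a vector field on `ℝ^d`. -/
def ZPerV (d : ℕ) (v : (Fin d → ℝ) → (Fin d → ℝ)) : Prop :=
  ∀ (x : Fin d → ℝ) (n : Fin d → ℤ), v (x + fun i => (n i : ℝ)) = v x

/-- The matrix field `(R g)_{ij}` produced by the inverse divergence operator with kernel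
`R_{ijk} = ((2−d)/(d−1)) Δ⁻²∂_i∂_j∂_k − (1/(d−1)) Δ⁻¹∂_k δ_{ij} + Δ⁻¹∂_i δ_{jk} + Δ⁻¹∂_j δ_{ik}`,
expressed through the potentials `φ = Δ⁻¹ g` and `χ = Δ⁻² g`. -/
noncomputable def invDivMatrix (d : ℕ) (φ χ : (Fin d → ℝ) → (Fin d → ℝ))
    (x : Fin d → ℝ) : Fin d → Fin d → ℝ := fun i j =>
  ((2 - (d : ℝ)) / ((d : ℝ) - 1))
      * ∑ k, pdd d i (fun y => pdd d j (fun z => pdd d k (fun w => χ w k) z) y) x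
    - (1 / ((d : ℝ) - 1)) * (if i = j then ∑ k, pdd d k (fun y => φ y k) x else 0)
    + pdd d i (fun y => φ y j) x + pdd d j (fun y => φ y i) x

/-- The `L^p` norm over the fundamental domain `[0,1]^d` of the torus. -/
noncomputable def lpNorm (d : ℕ) (p : ℝ≥0∞) {E : Type*} [NormedAddCommGroup E]
    (f : (Fin d → ℝ) → E) : ℝ≥0∞ :=
  eLpNorm f p (volume.restrict (Set.Icc (0 : Fin d → ℝ) 1))

/-- `ℤ^d`-periodicity of a scalar function on `ℝ^d`. -/
def ZPer (d : ℕ) (v : (Fin d → ℝ) → ℝ) : Prop :=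
  ∀ (x : Fin d → ℝ) (n : Fin d → ℤ), v (x + fun i => (n i : ℝ)) = v x

/-- The affine map `x ↦ σ x + z`, read on the torus, preserves the measure. -/
theorem measurePreserving_torus (d : ℕ) {σ : ℕ} (hσ : 0 < σ) (z : Fin d → ℝ) :
    MeasurePreserving (fun (x : Fin d → ℝ) (i : Fin d) => ((σ * x i + z i : ℝ) : UnitAddCircle))
      (volume.restrict (Set.Icc (0 : Fin d → ℝ) 1)) (Measure.pi fun _ => volume) := by
  have h1 : (volume.restrict (Set.Icc (0 : Fin d → ℝ) 1)) =
      Measure.pi (fun _ : Fin d => (volume : Measure ℝ).restrict (Set.Ioc 0 (0 + 1))) := by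
    rw [← Measure.restrict_pi_pi, volume_pi,
      ← Measure.restrict_congr_set Measure.univ_pi_Ioc_ae_eq_Icc]
    simp
  rw [h1]
  refine measurePreserving_pi (fun _ : Fin d => (volume : Measure ℝ).restrict (Set.Ioc 0 (0 + 1)))
    (fun _ => (volume : Measure UnitAddCircle))
    (f := fun i t => ((σ * t + z i : ℝ) : UnitAddCircle)) (fun i => ?_)
  have h2 := AddCircle.measurePreserving_mk 1 0
  have h3 : MeasurePreserving (fun t : UnitAddCircle => (σ : ℤ) • t) volume volume :=
    Measure.measurePreserving_zsmul volume (by exact_mod_cast hσ.ne')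
  have h4 : MeasurePreserving (fun t : UnitAddCircle => t + ((z i : ℝ) : UnitAddCircle))
      volume volume := measurePreserving_add_right volume _
  convert! h4.comp (h3.comp h2) using 2 with x
  simp

theorem ZPer.exists_lift {d : ℕ} {v : (Fin d → ℝ) → ℝ} (hv : ZPer d v) (hm : Measurable v) :
    ∃ h : (Fin d → UnitAddCircle) → ℝ, Measurable h ∧
      ∀ x : Fin d → ℝ, h (fun i => (x i : UnitAddCircle)) = v x := by
  refine ⟨fun t => v (fun i => (AddCircle.equivIoc 1 0 (t i)).1), ?_, fun x => ?_⟩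
  · refine hm.comp (measurable_pi_lambda _ fun i => ?_)
    exact measurable_subtype_coe.comp
      ((AddCircle.measurableEquivIoc 1 0).measurable.comp (measurable_pi_apply i))
  · rw [← hv x (fun i => - toIocDiv (zero_lt_one' ℝ) 0 (x i))]
    refine congrArg v (funext fun i => ?_)
    change toIocMod (zero_lt_one' ℝ) 0 (x i) = _
    simp [toIocMod, sub_eq_add_neg]

/-- The `L^p` norm over the cell is invariant under `x ↦ σ x + z` on periodic functions. -/
theorem ZPer.lpNorm_comp {d : ℕ} {v : (Fin d → ℝ) → ℝ} (hv : ZPer d v) (hm : Measurable v)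
    (p : ℝ≥0∞) {σ : ℕ} (hσ : 0 < σ) (z : Fin d → ℝ) :
    lpNorm d p (fun x => v ((σ : ℝ) • x + z)) = lpNorm d p v := by
  obtain ⟨h, hh, he⟩ := hv.exists_lift hm
  have key : ∀ {τ : ℕ} (_ : 0 < τ) (w : Fin d → ℝ),
      lpNorm d p (fun x => v ((τ : ℝ) • x + w)) = eLpNorm h p (Measure.pi fun _ => volume) := by
    intro τ hτ w
    rw [← eLpNorm_comp_measurePreserving hh.aestronglyMeasurable (measurePreserving_torus d hτ w)]
    unfold _root_.lpNorm
    congr 1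
    funext x
    rw [Function.comp, he (fun i => τ * x i + w i)]
    rfl
  rw [key hσ z, ← key one_pos 0]
  simp

theorem ZPer.lpNorm_sub {d : ℕ} {v : (Fin d → ℝ) → ℝ} (hv : ZPer d v) (hm : Measurable v)
    (p : ℝ≥0∞) (z : Fin d → ℝ) : lpNorm d p (fun x => v (x - z)) = lpNorm d p v := by
  simpa [sub_eq_add_neg] using hv.lpNorm_comp hm p one_pos (-z)

/-- Minkowski's integral inequality for superpositions of translates of a periodic function. -/
theorem ZPer.lpNorm_integral_le {d : ℕ} {v : (Fin d → ℝ) → ℝ} (hv : ZPer d v)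
    (hm : Measurable v) {p : ℝ≥0∞} (hp : 1 ≤ p) {Y : Type*} [MeasurableSpace Y] (μ : Measure Y)
    [IsFiniteMeasure μ] {a : Y → ℝ} {τ : Y → Fin d → ℝ} (hτ : Measurable τ)
    {M : ℝ≥0} (hM : ∀ᵐ y ∂μ, ‖a y‖ₑ ≤ M) :
    lpNorm d p (fun x => ∫ y, a y * v (x - τ y) ∂μ) ≤ M * μ Set.univ * lpNorm d p v := by
  set Q : Measure (Fin d → ℝ) := volume.restrict (Set.Icc (0 : Fin d → ℝ) 1)
  have hvm : Measurable (fun q : (Fin d → ℝ) × Y => v (q.1 - τ q.2)) :=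
    hm.comp (measurable_fst.sub (hτ.comp measurable_snd))
  have hpt : ∀ x, ‖∫ y, a y * v (x - τ y) ∂μ‖ₑ ≤ M * ∫⁻ y, ‖v (x - τ y)‖ₑ ∂μ := by
    intro x
    refine (enorm_integral_le_lintegral_enorm _).trans ?_
    rw [← lintegral_const_mul' _ _ ENNReal.coe_ne_top]
    refine lintegral_mono_ae (hM.mono fun y hy => ?_)
    rw [enorm_mul]
    gcongr
  rcases eq_or_ne p ∞ with rfl | hp'
  · set N := lpNorm d ∞ v with hN
    have h1 : ∀ y, ∀ᵐ x ∂Q, ‖v (x - τ y)‖ₑ ≤ N := fun y => by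
      rw [hN, ← hv.lpNorm_sub hm ∞ (τ y), _root_.lpNorm, eLpNorm_exponent_top]
      exact enorm_ae_le_eLpNormEssSup _ _
    have h2 : ∀ᵐ x ∂Q, ∀ᵐ y ∂μ, ‖v (x - τ y)‖ₑ ≤ N := by
      have hs : MeasurableSet {q : (Fin d → ℝ) × Y | ‖v (q.1 - τ q.2)‖ₑ ≤ N} :=
        measurableSet_le hvm.enorm measurable_const
      exact (Measure.ae_ae_comm hs).2 (Filter.Eventually.of_forall h1)
    rw [_root_.lpNorm, eLpNorm_exponent_top]
    refine eLpNormEssSup_le_of_ae_enorm_bound (h2.mono fun x hx => (hpt x).trans ?_)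
    rw [mul_assoc]
    gcongr
    calc ∫⁻ y, ‖v (x - τ y)‖ₑ ∂μ ≤ ∫⁻ _, N ∂μ := lintegral_mono_ae hx
      _ = μ Set.univ * N := by rw [lintegral_const, mul_comm]
  · have hp0 : p ≠ 0 := (zero_lt_one.trans_le hp).ne'
    have hr : 0 < p.toReal := ENNReal.toReal_pos hp0 hp'
    set r := p.toReal with hrdef
    have hpow : ∀ u : (Fin d → ℝ) → ℝ, (lpNorm d p u) ^ r = ∫⁻ x, ‖u x‖ₑ ^ r ∂Q := fun u => by
      rw [_root_.lpNorm, eLpNorm_eq_lintegral_rpow_enorm_toReal hp0 hp', ← ENNReal.rpow_mul, one_div,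
        inv_mul_cancel₀ hr.ne', ENNReal.rpow_one]
    have hjensen : ∀ x, (∫⁻ y, ‖v (x - τ y)‖ₑ ∂μ) ^ r ≤
        μ Set.univ ^ (r - 1) * ∫⁻ y, ‖v (x - τ y)‖ₑ ^ r ∂μ := by
      intro x
      have h := eLpNorm_le_eLpNorm_mul_rpow_measure_univ (μ := μ) hp
        (f := fun y => v (x - τ y))
        (hm.comp (measurable_const.sub hτ)).aestronglyMeasurable
      rw [eLpNorm_one_eq_lintegral_enorm, eLpNorm_eq_lintegral_rpow_enorm_toReal hp0 hp'] at h
      refine (ENNReal.rpow_le_rpow h hr.le).trans_eq ?_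
      rw [ENNReal.mul_rpow_of_nonneg _ _ hr.le, ← ENNReal.rpow_mul, ← ENNReal.rpow_mul, one_div,
        inv_mul_cancel₀ hr.ne', ENNReal.rpow_one, mul_comm]
      congr 2
      simp only [ENNReal.toReal_one, ← hrdef]
      field_simp
    rw [← ENNReal.rpow_le_rpow_iff hr, hpow, ENNReal.mul_rpow_of_nonneg _ _ hr.le,
      ENNReal.mul_rpow_of_nonneg _ _ hr.le]
    calc ∫⁻ x, ‖∫ y, a y * v (x - τ y) ∂μ‖ₑ ^ r ∂Q
        ≤ ∫⁻ x, (M : ℝ≥0∞) ^ r * (μ Set.univ ^ (r - 1) * ∫⁻ y, ‖v (x - τ y)‖ₑ ^ r ∂μ) ∂Q := by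
          refine lintegral_mono fun x => ?_
          refine (ENNReal.rpow_le_rpow (hpt x) hr.le).trans ?_
          rw [ENNReal.mul_rpow_of_nonneg _ _ hr.le]
          gcongr
          exact hjensen x
      _ = (M : ℝ≥0∞) ^ r * (μ Set.univ ^ (r - 1) * ∫⁻ y, ∫⁻ x, ‖v (x - τ y)‖ₑ ^ r ∂Q ∂μ) := by
          rw [lintegral_const_mul' _ _ (by finiteness), lintegral_const_mul' _ _ ?_,
            lintegral_lintegral_swap]
          · exact (hvm.enorm.pow_const r).aemeasurable
          · refine ENNReal.rpow_ne_top_of_nonneg ?_ (measure_ne_top _ _)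
            have := ENNReal.toReal_mono hp' hp
            simp at this
            linarith
      _ = (M : ℝ≥0∞) ^ r * (μ Set.univ ^ (r - 1) * (lpNorm d p v ^ r * μ Set.univ)) := by
          congr 2
          rw [← lintegral_const]
          refine lintegral_congr fun y => ?_
          rw [← hpow, hv.lpNorm_sub hm]
      _ = (M : ℝ≥0∞) ^ r * μ Set.univ ^ r * lpNorm d p v ^ r := by
          have : μ Set.univ ^ r = μ Set.univ ^ (r - 1) * μ Set.univ := by
            have h1 : 0 ≤ r - 1 := by
              have := ENNReal.toReal_mono hp' hp
              simp at this
              linarith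
            conv_lhs => rw [show r = (r - 1) + 1 by ring,
              ENNReal.rpow_add_of_nonneg _ _ h1 zero_le_one, ENNReal.rpow_one]
          rw [this]
          ring

section PartialDerivatives

variable {d : ℕ} {f g : (Fin d → ℝ) → ℝ}

theorem ContDiff.pdd (hf : ContDiff ℝ (⊤ : ℕ∞) f) (i : Fin d) :
    ContDiff ℝ (⊤ : ℕ∞) (pdd d i f) :=
  (hf.fderiv_right (m := ((⊤ : ℕ∞) : WithTop ℕ∞)) (by simp)).clm_apply contDiff_const

theorem ContDiff.differentiableAt_of_smooth (hf : ContDiff ℝ (⊤ : ℕ∞) f) (x : Fin d → ℝ) :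
    DifferentiableAt ℝ f x :=
  hf.contDiffAt.differentiableAt (by simp)

theorem pdd_comm (hf : ContDiff ℝ (⊤ : ℕ∞) f) (i j : Fin d) :
    pdd d i (pdd d j f) = pdd d j (pdd d i f) := by
  funext x
  have hd : DifferentiableAt ℝ (fderiv ℝ f) x :=
    (hf.fderiv_right (m := ((⊤ : ℕ∞) : WithTop ℕ∞)) (by simp)).contDiffAt.differentiableAt
      (by simp)
  have key : ∀ i j : Fin d, pdd d i (pdd d j f) x =
      fderiv ℝ (fderiv ℝ f) x (Pi.single i 1) (Pi.single j 1) := by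
    intro i j
    unfold pdd
    rw [fderiv_clm_apply hd (differentiableAt_const _)]
    simp
  rw [key, key]
  have hs : IsSymmSndFDerivAt ℝ f x :=
    hf.contDiffAt.isSymmSndFDerivAt (by simp; exact WithTop.coe_le_coe.2 le_top)
  exact hs _ _

theorem pdd_comp_affine (hf : ContDiff ℝ (⊤ : ℕ∞) f) (i : Fin d) (x : Fin d → ℝ) (c : ℝ)
    (y : Fin d → ℝ) :
    pdd d i (fun y => f (x + c • y)) y = c * pdd d i f (x + c • y) := by
  unfold pdd
  have h1 : HasFDerivAt (fun y : Fin d → ℝ => x + c • y)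
      (c • ContinuousLinearMap.id ℝ (Fin d → ℝ)) y :=
    ((hasFDerivAt_id y).const_smul c).const_add x
  have h2 := ((hf.differentiableAt_of_smooth (x + c • y)).hasFDerivAt).comp y h1
  rw [show (fun y => f (x + c • y)) = f ∘ fun y => x + c • y from rfl, h2.fderiv]
  simp

theorem pdd_comp_smul (hf : ContDiff ℝ (⊤ : ℕ∞) f) (i : Fin d) (c : ℝ) :
    pdd d i (fun y => f (c • y)) = fun y => c * pdd d i f (c • y) := by
  funext y
  simpa using pdd_comp_affine hf i 0 c y

theorem pdd_comp_add (hf : ContDiff ℝ (⊤ : ℕ∞) f) (i : Fin d) (z : Fin d → ℝ) :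
    pdd d i (fun y => f (y + z)) = fun y => pdd d i f (y + z) := by
  funext y
  simpa [add_comm] using pdd_comp_affine hf i z 1 y

theorem pdd_sub (hf : ContDiff ℝ (⊤ : ℕ∞) f) (hg : ContDiff ℝ (⊤ : ℕ∞) g) (i : Fin d) :
    pdd d i (fun y => f y - g y) = fun y => pdd d i f y - pdd d i g y := by
  funext y
  unfold pdd
  rw [fderiv_fun_sub (hf.differentiableAt_of_smooth y) (hg.differentiableAt_of_smooth y)]
  rfl

theorem pdd_mul (hf : ContDiff ℝ (⊤ : ℕ∞) f) (hg : ContDiff ℝ (⊤ : ℕ∞) g) (i : Fin d) :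
    pdd d i (fun y => f y * g y) = fun y => f y * pdd d i g y + pdd d i f y * g y := by
  funext y
  unfold pdd
  rw [fderiv_fun_mul (hf.differentiableAt_of_smooth y) (hg.differentiableAt_of_smooth y)]
  simp [mul_comm]

theorem pdd_const_mul (hf : ContDiff ℝ (⊤ : ℕ∞) f) (c : ℝ) (i : Fin d) :
    pdd d i (fun y => c * f y) = fun y => c * pdd d i f y := by
  funext y
  unfold pdd
  rw [fderiv_const_mul (hf.differentiableAt_of_smooth y)]
  simp

theorem pdd_sum {ι : Type*} (s : Finset ι) {F : ι → (Fin d → ℝ) → ℝ}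
    (hF : ∀ a, ContDiff ℝ (⊤ : ℕ∞) (F a)) (i : Fin d) :
    pdd d i (fun y => ∑ a ∈ s, F a y) = fun y => ∑ a ∈ s, pdd d i (F a) y := by
  funext y
  unfold pdd
  rw [fderiv_fun_sum fun a _ => (hF a).differentiableAt_of_smooth y]
  simp

theorem pdd_coord (i l : Fin d) (y : Fin d → ℝ) :
    pdd d l (fun y => y i) y = if i = l then 1 else 0 := by
  unfold pdd
  rw [(hasFDerivAt_apply (𝕜 := ℝ) i y).fderiv]
  simp [Pi.single_apply]

theorem ContDiff.lap (hf : ContDiff ℝ (⊤ : ℕ∞) f) : ContDiff ℝ (⊤ : ℕ∞) (lap d f) :=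
  ContDiff.sum fun i _ => (hf.pdd i).pdd i

theorem pdd_lap (hf : ContDiff ℝ (⊤ : ℕ∞) f) (i : Fin d) :
    pdd d i (lap d f) = lap d (pdd d i f) := by
  unfold lap
  rw [pdd_sum _ (fun j => (hf.pdd j).pdd j)]
  funext y
  refine Finset.sum_congr rfl fun j _ => ?_
  change pdd d i (pdd d j (pdd d j f)) y = pdd d j (pdd d j (pdd d i f)) y
  rw [pdd_comm (hf.pdd j), pdd_comm hf]

theorem lap_sub (hf : ContDiff ℝ (⊤ : ℕ∞) f) (hg : ContDiff ℝ (⊤ : ℕ∞) g) :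
    lap d (fun y => f y - g y) = fun y => lap d f y - lap d g y := by
  funext y
  unfold lap
  rw [← Finset.sum_sub_distrib]
  refine Finset.sum_congr rfl fun j _ => ?_
  rw [pdd_sub hf hg, pdd_sub (hf.pdd j) (hg.pdd j)]

theorem lap_comp_add (hf : ContDiff ℝ (⊤ : ℕ∞) f) (z : Fin d → ℝ) :
    lap d (fun y => f (y + z)) = fun y => lap d f (y + z) := by
  funext y
  unfold lap
  refine Finset.sum_congr rfl fun j _ => ?_
  rw [pdd_comp_add hf, pdd_comp_add (hf.pdd j)]

theorem lap_comp_smul (hf : ContDiff ℝ (⊤ : ℕ∞) f) (c : ℝ) :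
    lap d (fun y => f (c • y)) = fun y => c ^ 2 * lap d f (c • y) := by
  funext y
  unfold lap
  rw [Finset.mul_sum]
  refine Finset.sum_congr rfl fun j _ => ?_
  rw [pdd_comp_smul hf, pdd_const_mul, pdd_comp_smul (hf.pdd j)]
  · ring
  · exact (hf.pdd j).comp (contDiff_const_smul c)

theorem lap_const_mul (hf : ContDiff ℝ (⊤ : ℕ∞) f) (c : ℝ) :
    lap d (fun y => c * f y) = fun y => c * lap d f y := by
  funext y
  unfold lap
  rw [Finset.mul_sum]
  refine Finset.sum_congr rfl fun j _ => ?_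
  rw [pdd_const_mul hf, pdd_const_mul (hf.pdd j)]

theorem ZPer.pdd (hv : ZPer d f) (hf : ContDiff ℝ (⊤ : ℕ∞) f) (i : Fin d) :
    ZPer d (pdd d i f) := by
  intro x n
  have h := congrFun (pdd_comp_add hf i fun i => (n i : ℝ)) x
  rw [← h]
  congr 1
  funext y
  exact hv y n

theorem ZPer.lap (hv : ZPer d f) (hf : ContDiff ℝ (⊤ : ℕ∞) f) : ZPer d (lap d f) := by
  intro x n
  exact Finset.sum_congr rfl fun i _ => (hv.pdd hf i).pdd (hf.pdd i) i x n

theorem pdd_eq_zero_of_norm_lt {R : ℝ} (hf : ∀ y, R < ‖y‖ → f y = 0) (i : Fin d)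
    (y : Fin d → ℝ) (hy : R < ‖y‖) : pdd d i f y = 0 := by
  have : f =ᶠ[nhds y] fun _ => 0 :=
    (continuous_norm.continuousAt.eventually_const_lt hy).mono hf
  unfold pdd
  rw [this.fderiv_eq]
  simp

theorem hasCompactSupport_of_norm_lt {R : ℝ} (hf : ∀ y, R < ‖y‖ → f y = 0) :
    HasCompactSupport f :=
  HasCompactSupport.intro (isCompact_closedBall (0 : Fin d → ℝ) R) fun y hy =>
    hf y (by simpa using hy)

/-- Integration by parts against a dilated translate. -/
theorem integral_pdd_mul {R : ℝ} (hf : ContDiff ℝ (⊤ : ℕ∞) f) (hf0 : ∀ y, R < ‖y‖ → f y = 0)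
    (hg : ContDiff ℝ (⊤ : ℕ∞) g) (i : Fin d) (x : Fin d → ℝ) (s : ℝ) :
    ∫ y, pdd d i f y * g (x - s • y) = s * ∫ y, f y * pdd d i g (x - s • y) := by
  have hG : ContDiff ℝ (⊤ : ℕ∞) fun y => g (x + (-s) • y) :=
    hg.comp (contDiff_const.add (contDiff_const_smul (-s)))
  have hfc := hasCompactSupport_of_norm_lt hf0
  have hfc' := hasCompactSupport_of_norm_lt (pdd_eq_zero_of_norm_lt hf0 i)
  have h := integral_mul_fderiv_eq_neg_fderiv_mul_of_integrable (μ := volume)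
    (f := f) (g := fun y => g (x + (-s) • y)) (v := Pi.single i 1)
    (((hf.pdd i).continuous.mul hG.continuous).integrable_of_hasCompactSupport hfc'.mul_right)
    ((hf.continuous.mul (hG.pdd i).continuous).integrable_of_hasCompactSupport hfc.mul_right)
    ((hf.continuous.mul hG.continuous).integrable_of_hasCompactSupport hfc.mul_right)
    (fun y _ => hf.differentiableAt_of_smooth y) (fun y _ => hG.differentiableAt_of_smooth y)
  change ∫ y, f y * pdd d i (fun y => g (x + (-s) • y)) y =
    -∫ y, pdd d i f y * g (x + (-s) • y) at h
  simp only [fun y => pdd_comp_affine hg i x (-s) y] at h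
  simp only [neg_smul, ← sub_eq_add_neg] at h
  rw [← neg_eq_iff_eq_neg.2 h, ← integral_const_mul, ← integral_neg]
  congr 1
  funext y
  ring

end PartialDerivatives

section Kernel

theorem exists_smooth_antideriv {b : ℝ → ℝ} (hb : ContDiff ℝ (⊤ : ℕ∞) b)
    (hb0 : ∀ s, 1 ≤ s → b s = 0) :
    ∃ B : ℝ → ℝ, ContDiff ℝ (⊤ : ℕ∞) B ∧ deriv B = b ∧ ∀ s, 1 ≤ s → B s = 0 := by
  have hd : ∀ s, HasDerivAt (fun s => ∫ t in (1 : ℝ)..s, b t) (b s) s := fun s =>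
    intervalIntegral.integral_hasDerivAt_right (hb.continuous.intervalIntegrable _ _)
      (hb.continuous.stronglyMeasurableAtFilter _ _) hb.continuous.continuousAt
  have hde : deriv (fun s => ∫ t in (1 : ℝ)..s, b t) = b := funext fun s => (hd s).deriv
  refine ⟨fun s => ∫ t in (1 : ℝ)..s, b t, ?_, hde, fun s hs => ?_⟩
  · rw [contDiff_infty_iff_deriv, hde]
    exact ⟨fun s => (hd s).differentiableAt, hb⟩
  · change ∫ t in (1 : ℝ)..s, b t = 0
    rw [intervalIntegral.integral_congr (g := fun _ => (0 : ℝ))]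
    · simp
    · intro t ht
      rw [Set.uIcc_of_le hs] at ht
      exact hb0 t ht.1

variable {d : ℕ}

theorem contDiff_half_sum_sq :
    ContDiff ℝ (⊤ : ℕ∞) fun y : Fin d → ℝ => (∑ i, y i ^ 2) / 2 := by
  fun_prop

theorem pdd_comp_half_sum_sq {h : ℝ → ℝ} (hh : ContDiff ℝ (⊤ : ℕ∞) h) (l : Fin d)
    (y : Fin d → ℝ) :
    pdd d l (fun y => h ((∑ i, y i ^ 2) / 2)) y = y l * deriv h ((∑ i, y i ^ 2) / 2) := by
  have h1 : HasFDerivAt (fun y : Fin d → ℝ => (∑ i, y i ^ 2) / 2)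
      ((2 : ℝ)⁻¹ • ∑ i, (2 * y i) • ContinuousLinearMap.proj (R := ℝ) (φ := fun _ => ℝ) i) y := by
    have : ∀ i ∈ Finset.univ, HasFDerivAt (fun y : Fin d → ℝ => y i ^ 2)
        ((2 * y i) • ContinuousLinearMap.proj (R := ℝ) (φ := fun _ => ℝ) i) y := fun i _ => by
      simpa using (hasFDerivAt_apply (𝕜 := ℝ) i y).pow 2
    simpa [div_eq_inv_mul] using (HasFDerivAt.fun_sum this).const_mul (2 : ℝ)⁻¹
  have h2 : HasDerivAt h (deriv h ((∑ i, y i ^ 2) / 2)) ((∑ i, y i ^ 2) / 2) :=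
    (hh.contDiffAt.differentiableAt (by simp)).hasDerivAt
  unfold pdd
  rw [show (fun y : Fin d → ℝ => h ((∑ i, y i ^ 2) / 2)) =
    h ∘ fun y => (∑ i, y i ^ 2) / 2 from rfl, (h2.comp_hasFDerivAt y h1).fderiv]
  simp [Pi.single_apply]
  ring

theorem one_le_half_sum_sq {y : Fin d → ℝ} (hy : 2 < ‖y‖) : 1 ≤ (∑ i, y i ^ 2) / 2 := by
  obtain ⟨i, hi⟩ : ∃ i, 2 < ‖y i‖ := by
    by_contra! h
    exact absurd ((pi_norm_le_iff_of_nonneg (by norm_num)).2 h) (not_le.2 hy)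
  have h1 : y i ^ 2 ≤ ∑ i, y i ^ 2 :=
    Finset.single_le_sum (f := fun i => y i ^ 2) (fun i _ => sq_nonneg _) (Finset.mem_univ i)
  have h2 : (2 : ℝ) ^ 2 ≤ y i ^ 2 := by
    rw [← sq_abs (y i)]
    exact pow_le_pow_left₀ (by norm_num) hi.le 2
  linarith

/-- A smooth compactly supported kernel `k` such that `∇ Δ k (y) = ρ(y) y` with `∫ ρ > 0`. -/
theorem exists_biharmonic_kernel (d : ℕ) : ∃ k ρ : (Fin d → ℝ) → ℝ,
    ContDiff ℝ (⊤ : ℕ∞) k ∧ ContDiff ℝ (⊤ : ℕ∞) ρ ∧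
    (∀ y, 2 < ‖y‖ → k y = 0) ∧ (∀ y, 2 < ‖y‖ → ρ y = 0) ∧
    (∀ l y, pdd d l (lap d k) y = y l * ρ y) ∧ 0 < ∫ y, ρ y := by
  let β : ContDiffBump (0 : ℝ) := ⟨1 / 2, 1, by norm_num, by norm_num⟩
  have hβ : ContDiff ℝ (⊤ : ℕ∞) β := β.contDiff
  have hβ0 : ∀ s, 1 ≤ s → β s = 0 := fun s hs => β.zero_of_le_dist (by
    simpa [β] using hs.trans (le_abs_self s))
  obtain ⟨m₁, hm₁, hm₁d, hm₁0⟩ := exists_smooth_antideriv hβ hβ0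
  obtain ⟨m, hm, hmd, hm0⟩ := exists_smooth_antideriv hm₁ hm₁0
  have hβ' : ContDiff ℝ (⊤ : ℕ∞) (deriv β) := (contDiff_infty_iff_deriv.1 hβ).2
  set q : (Fin d → ℝ) → ℝ := fun y => (∑ i, y i ^ 2) / 2 with hq
  have hqs : ContDiff ℝ (⊤ : ℕ∞) q := contDiff_half_sum_sq
  have hcoord : ∀ l : Fin d, ContDiff ℝ (⊤ : ℕ∞) fun y : Fin d → ℝ => y l := fun l =>
    contDiff_apply ℝ ℝ l
  have hlap : lap d (fun y => m (q y)) = fun y => d * m₁ (q y) + 2 * q y * β (q y) := by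
    funext y
    unfold lap
    have : ∀ l, pdd d l (fun y => m (q y)) = fun y => y l * m₁ (q y) := fun l => funext fun y => by
      rw [← hmd]; exact pdd_comp_half_sum_sq hm l y
    simp only [this]
    have : ∀ l, pdd d l (fun y => y l * m₁ (q y)) y = y l ^ 2 * β (q y) + m₁ (q y) := fun l => by
      have hm₁q : ContDiff ℝ (⊤ : ℕ∞) fun y => m₁ (q y) := hm₁.comp hqs
      rw [pdd_mul (hcoord l) hm₁q]
      simp only [hq, pdd_coord]
      rw [pdd_comp_half_sum_sq hm₁, hm₁d]
      simp
      ring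
    simp only [this, Finset.sum_add_distrib, ← Finset.sum_mul]
    simp [hq]
    ring
  set G : ℝ → ℝ := fun s => d * m₁ s + 2 * s * β s with hG
  have hGs : ContDiff ℝ (⊤ : ℕ∞) G := by fun_prop
  have hGd : deriv G = fun s => (d + 2) * β s + 2 * s * deriv β s := by
    funext s
    have h1 : HasDerivAt m₁ (β s) s := by
      rw [← hm₁d]; exact (hm₁.contDiffAt.differentiableAt (by simp)).hasDerivAt
    have h2 : HasDerivAt β (deriv β s) s :=
      (hβ.contDiffAt.differentiableAt (by simp)).hasDerivAt
    have h3 : HasDerivAt G _ s :=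
      (h1.const_mul (d : ℝ)).add (((hasDerivAt_id s).const_mul 2).mul h2)
    rw [h3.deriv]
    simp
    ring
  have hβq : ∀ y, 2 < ‖y‖ → β (q y) = 0 := fun y hy => hβ0 _ (one_le_half_sum_sq hy)
  have hpβ : ∀ l y, pdd d l (fun y => β (q y)) y = y l * deriv β (q y) := fun l y =>
    pdd_comp_half_sum_sq hβ l y
  have hβqs : ContDiff ℝ (⊤ : ℕ∞) fun y => β (q y) := hβ.comp hqs
  have hρ : ∀ y, deriv G (q y) =
      (d + 2) * β (q y) + ∑ l, pdd d l (fun y => β (q y)) y * y l := by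
    intro y
    rw [hGd]
    simp only [hpβ]
    rw [show ∑ l, y l * deriv β (q y) * y l = (∑ l, y l ^ 2) * deriv β (q y) by
      rw [Finset.sum_mul]; exact Finset.sum_congr rfl fun _ _ => by ring]
    simp only [hq]
    ring
  have hρ0 : ∀ y, 2 < ‖y‖ → deriv G (q y) = 0 := fun y hy => by
    rw [hρ, hβq y hy]
    simp [pdd_eq_zero_of_norm_lt hβq _ y hy]
  refine ⟨fun y => m (q y), fun y => deriv G (q y), hm.comp hqs,
    (contDiff_infty_iff_deriv.1 hGs).2.comp hqs, fun y hy => hm0 _ (one_le_half_sum_sq hy), hρ0,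
    fun l y => ?_, ?_⟩
  · rw [hlap]
    exact pdd_comp_half_sum_sq hGs l y
  · have integrable_l : ∀ l, Integrable (fun y => pdd d l (fun y => β (q y)) y * y l) volume := fun l =>
      ((hβqs.pdd l).continuous.mul (hcoord l).continuous).integrable_of_hasCompactSupport
        (hasCompactSupport_of_norm_lt (pdd_eq_zero_of_norm_lt hβq l)).mul_right
    have integrable_lβ : Integrable (fun y => β (q y)) volume :=
      hβqs.continuous.integrable_of_hasCompactSupport (hasCompactSupport_of_norm_lt hβq)
    have hibp : ∀ l, ∫ y, pdd d l (fun y => β (q y)) y * y l = - ∫ y, β (q y) := fun l => by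
      have h := integral_pdd_mul hβqs hβq (hcoord l) l 0 (-1)
      simp only [pdd_coord] at h
      simpa using h
    simp only [hρ]
    rw [integral_add (integrable_lβ.const_mul _) (integrable_finsetSum _ fun l _ => integrable_l l),
      integral_finsetSum _ fun l _ => integrable_l l, integral_const_mul]
    simp only [hibp, Finset.sum_const, Finset.card_univ, Fintype.card_fin, nsmul_eq_mul]
    have hpos : 0 < ∫ y, β (q y) :=
      hβqs.continuous.integral_pos_of_hasCompactSupport_nonneg_nonzero
        (hasCompactSupport_of_norm_lt hβq) (fun y => β.nonneg) (x := 0) (by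
          simp only [hq]
          rw [β.one_of_mem_closedBall] <;> simp [β])
    linarith

end Kernel

section Representation

variable {d : ℕ}

theorem sum_integral_pdd_mul_pdd {a b : (Fin d → ℝ) → ℝ} {R : ℝ} (ha : ContDiff ℝ (⊤ : ℕ∞) a)
    (ha0 : ∀ y, R < ‖y‖ → a y = 0) (hb : ContDiff ℝ (⊤ : ℕ∞) b) (x : Fin d → ℝ) (s : ℝ) :
    ∑ l, ∫ y, pdd d l a y * pdd d l b (x - s • y) = s * ∫ y, a y * lap d b (x - s • y) := by
  simp only [fun l => integral_pdd_mul ha ha0 (hb.pdd l) l x s]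
  rw [← Finset.mul_sum, ← integral_finsetSum]
  · simp only [← Finset.mul_sum]
    rfl
  · intro l _
    have h : Continuous fun y => pdd d l (pdd d l b) (x - s • y) :=
      ((hb.pdd l).pdd l).continuous.comp (by fun_prop)
    exact (ha.continuous.mul h).integrable_of_hasCompactSupport
      (hasCompactSupport_of_norm_lt ha0).mul_right

theorem integral_lap_mul {a b : (Fin d → ℝ) → ℝ} {R : ℝ} (ha : ContDiff ℝ (⊤ : ℕ∞) a)
    (ha0 : ∀ y, R < ‖y‖ → a y = 0) (hb : ContDiff ℝ (⊤ : ℕ∞) b) (x : Fin d → ℝ) (s : ℝ) :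
    ∫ y, lap d a y * b (x - s • y) = s ^ 2 * ∫ y, a y * lap d b (x - s • y) := by
  have hbx : Continuous fun y => b (x - s • y) := hb.continuous.comp (by fun_prop)
  unfold lap
  simp only [Finset.sum_mul]
  rw [integral_finsetSum]
  · simp only [fun l => integral_pdd_mul (ha.pdd l) (pdd_eq_zero_of_norm_lt ha0 l) hb l x s]
    rw [← Finset.mul_sum, sum_integral_pdd_mul_pdd ha ha0 hb]
    unfold lap
    ring
  · intro l _
    exact (((ha.pdd l).pdd l).continuous.mul hbx).integrable_of_hasCompactSupport
      (hasCompactSupport_of_norm_lt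
        (pdd_eq_zero_of_norm_lt (pdd_eq_zero_of_norm_lt ha0 l) l)).mul_right

theorem lap_eq_zero_of_norm_lt {a : (Fin d → ℝ) → ℝ} {R : ℝ} (ha0 : ∀ y, R < ‖y‖ → a y = 0)
    (y : Fin d → ℝ) (hy : R < ‖y‖) : lap d a y = 0 :=
  Finset.sum_eq_zero fun l _ => pdd_eq_zero_of_norm_lt (pdd_eq_zero_of_norm_lt ha0 l) l y hy

theorem apply_eq_sum_mul_single (L : (Fin d → ℝ) →L[ℝ] ℝ) (y : Fin d → ℝ) :
    L y = ∑ l, y l * L (Pi.single l 1) := by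
  conv_lhs => rw [← Finset.univ_sum_single y, map_sum]
  refine Finset.sum_congr rfl fun l _ => ?_
  rw [← smul_eq_mul, ← map_smul, ← Pi.single_smul, smul_eq_mul, mul_one]

theorem sub_comp_smul_eq_integral {v : (Fin d → ℝ) → ℝ} (hv : ContDiff ℝ (⊤ : ℕ∞) v)
    (x y : Fin d → ℝ) (T : ℝ) :
    v x - v (x - T • y) = ∫ s in (0 : ℝ)..T, ∑ l, y l * pdd d l v (x - s • y) := by
  have hd : ∀ s : ℝ, HasDerivAt (fun s : ℝ => - v (x - s • y))
      (∑ l, y l * pdd d l v (x - s • y)) s := by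
    intro s
    have h1 : HasDerivAt (fun s : ℝ => x - s • y) (-y) s := by
      simpa using ((hasDerivAt_id s).smul_const y).const_sub x
    have h2 := ((hv.differentiableAt_of_smooth (x - s • y)).hasFDerivAt.comp_hasDerivAt s h1).neg
    convert! h2 using 1
    rw [map_neg, neg_neg]
    exact (apply_eq_sum_mul_single _ y).symm
  rw [intervalIntegral.integral_eq_sub_of_hasDerivAt (fun s _ => hd s)]
  · simp
    ring
  · refine Continuous.intervalIntegrable ?_ _ _
    refine continuous_finsetSum _ fun l _ => continuous_const.mul ?_
    exact (hv.pdd l).continuous.comp (by fun_prop)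

/-- Lebesgue measure on `[0, T]` times a ball of radius `3`. -/
def cylMeasure (d : ℕ) (T : ℝ) : Measure (ℝ × (Fin d → ℝ)) :=
  (volume.restrict (Set.Icc 0 T)).prod (volume.restrict (Metric.closedBall 0 3))

instance (T : ℝ) : IsFiniteMeasure (volume.restrict (Set.Icc (0 : ℝ) T)) :=
  ⟨by simp⟩

instance : IsFiniteMeasure
    ((volume : Measure (Fin d → ℝ)).restrict (Metric.closedBall 0 3)) :=
  ⟨by rw [Measure.restrict_apply_univ]; exact measure_closedBall_lt_top⟩

instance (T : ℝ) : IsFiniteMeasure (cylMeasure d T) := by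
  unfold cylMeasure; infer_instance

theorem integrable_cylMeasure {Φ : ℝ × (Fin d → ℝ) → ℝ} (hΦ : Continuous Φ) (T : ℝ) :
    Integrable Φ (cylMeasure d T) := by
  rw [cylMeasure, Measure.prod_restrict]
  exact hΦ.continuousOn.integrableOn_compact (isCompact_Icc.prod (isCompact_closedBall 0 3))

theorem integral_cylMeasure {Φ : ℝ × (Fin d → ℝ) → ℝ} (hΦ : Continuous Φ) (T : ℝ)
    (h0 : ∀ s ∈ Set.Icc 0 T, ∀ y, 3 < ‖y‖ → Φ (s, y) = 0) :
    ∫ q, Φ q ∂(cylMeasure d T) = ∫ s in Set.Icc 0 T, ∫ y, Φ (s, y) := by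
  have h := integral_prod _ (integrable_cylMeasure hΦ T)
  rw [← cylMeasure] at h
  rw [h]
  exact setIntegral_congr_fun measurableSet_Icc fun s hs =>
    setIntegral_eq_integral_of_forall_compl_eq_zero fun y hy => h0 s hs y (by simpa using hy)

theorem integral_cylMeasure_symm {Φ : ℝ × (Fin d → ℝ) → ℝ} (hΦ : Continuous Φ) (T : ℝ)
    (h0 : ∀ s ∈ Set.Icc 0 T, ∀ y, 3 < ‖y‖ → Φ (s, y) = 0) :
    ∫ q, Φ q ∂(cylMeasure d T) = ∫ y, ∫ s in Set.Icc 0 T, Φ (s, y) := by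
  have h := integral_prod_symm _ (integrable_cylMeasure hΦ T)
  rw [← cylMeasure] at h
  rw [h]
  refine setIntegral_eq_integral_of_forall_compl_eq_zero fun y hy => ?_
  exact setIntegral_eq_zero_of_forall_eq_zero fun s hs => h0 s hs y (by simpa using hy)

/-- Recovery of a third derivative from its average at scale `T` and the bilaplacian. -/
theorem third_derivative_representation {k ρ : (Fin d → ℝ) → ℝ} (hk : ContDiff ℝ (⊤ : ℕ∞) k)
    (hρ : ContDiff ℝ (⊤ : ℕ∞) ρ) (hk0 : ∀ y, 2 < ‖y‖ → k y = 0)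
    (hρ0 : ∀ y, 2 < ‖y‖ → ρ y = 0) (hkρ : ∀ l y, pdd d l (lap d k) y = y l * ρ y)
    {u : (Fin d → ℝ) → ℝ} (hu : ContDiff ℝ (⊤ : ℕ∞) u) (i j m : Fin d) {T : ℝ} (hT : 0 ≤ T)
    (x : Fin d → ℝ) :
    (∫ y, ρ y) * pdd d i (pdd d j (pdd d m u)) x =
      (∫ y, ρ y * pdd d i (pdd d j (pdd d m u)) (x - T • y)) +
      ∫ q, pdd d m (pdd d j (pdd d i k)) q.2 * lap d (lap d u) (x - q.1 • q.2)
        ∂(cylMeasure d T) := by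
  set v := pdd d i (pdd d j (pdd d m u)) with hvdef
  set g := lap d (lap d u) with hgdef
  have hg : ContDiff ℝ (⊤ : ℕ∞) g := hu.lap.lap
  have hv : ContDiff ℝ (⊤ : ℕ∞) v := ((hu.pdd m).pdd j).pdd i
  have hvx : Continuous fun y => v (x - T • y) := hv.continuous.comp (by fun_prop)
  have hρc := hasCompactSupport_of_norm_lt hρ0
  have hlap : lap d (lap d v) = pdd d i (pdd d j (pdd d m g)) := by
    rw [hgdef, pdd_lap hu.lap, pdd_lap hu, pdd_lap (hu.pdd m).lap, pdd_lap (hu.pdd m),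
      pdd_lap ((hu.pdd m).pdd j).lap, pdd_lap ((hu.pdd m).pdd j)]
  have hfix : ∀ s : ℝ, ∫ y, ρ y * ∑ l, y l * pdd d l v (x - s • y) =
      ∫ y, pdd d m (pdd d j (pdd d i k)) y * g (x - s • y) := by
    intro s
    have h1 : ∀ y : Fin d → ℝ, ρ y * ∑ l, y l * pdd d l v (x - s • y) =
        ∑ l, pdd d l (lap d k) y * pdd d l v (x - s • y) := fun y => by
      rw [Finset.mul_sum]
      refine Finset.sum_congr rfl fun l _ => ?_
      rw [hkρ]
      ring
    simp only [h1]
    rw [integral_finsetSum, sum_integral_pdd_mul_pdd hk.lap (lap_eq_zero_of_norm_lt hk0) hv,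
      integral_lap_mul hk hk0 hv.lap, hlap,
      integral_pdd_mul ((hk.pdd i).pdd j)
        (pdd_eq_zero_of_norm_lt (pdd_eq_zero_of_norm_lt hk0 i) j) hg,
      integral_pdd_mul (hk.pdd i) (pdd_eq_zero_of_norm_lt hk0 i) (hg.pdd m),
      integral_pdd_mul hk hk0 ((hg.pdd m).pdd j)]
    · ring
    · intro l _
      have h : Continuous fun y => pdd d l v (x - s • y) :=
        (hv.pdd l).continuous.comp (by fun_prop)
      exact ((hk.lap.pdd l).continuous.mul h).integrable_of_hasCompactSupport
        (hasCompactSupport_of_norm_lt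
          (pdd_eq_zero_of_norm_lt (lap_eq_zero_of_norm_lt hk0) l)).mul_right
  have hK0 := pdd_eq_zero_of_norm_lt
    (pdd_eq_zero_of_norm_lt (pdd_eq_zero_of_norm_lt hk0 i) j) m
  have hΦ : Continuous fun q : ℝ × (Fin d → ℝ) =>
      ρ q.2 * ∑ l, q.2 l * pdd d l v (x - q.1 • q.2) := by
    refine (hρ.continuous.comp continuous_snd).mul (continuous_finsetSum _ fun l _ => ?_)
    exact ((continuous_apply l).comp continuous_snd).mul
      ((hv.pdd l).continuous.comp (by fun_prop))
  have hΨ : Continuous fun q : ℝ × (Fin d → ℝ) =>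
      pdd d m (pdd d j (pdd d i k)) q.2 * g (x - q.1 • q.2) :=
    ((((hk.pdd i).pdd j).pdd m).continuous.comp continuous_snd).mul
      (hg.continuous.comp (by fun_prop))
  rw [integral_cylMeasure hΨ T fun s _ y hy => by simp [hK0 y (by linarith)]]
  simp only [← hfix]
  rw [← integral_cylMeasure hΦ T fun s _ y hy => by simp [hρ0 y (by linarith)],
    integral_cylMeasure_symm hΦ T fun s _ y hy => by simp [hρ0 y (by linarith)]]
  have h2 : ∀ y, ∫ s in Set.Icc 0 T, ρ y * ∑ l, y l * pdd d l v (x - s • y) =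
      ρ y * v x - ρ y * v (x - T • y) := fun y => by
    rw [integral_const_mul, integral_Icc_eq_integral_Ioc, ← intervalIntegral.integral_of_le hT,
      ← sub_comp_smul_eq_integral hv]
    ring
  simp only [h2]
  rw [integral_sub, integral_mul_const]
  · ring
  · exact (hρ.continuous.integrable_of_hasCompactSupport hρc).mul_const _
  · exact (hρ.continuous.mul hvx).integrable_of_hasCompactSupport hρc.mul_right

/-- An average of a derivative of a periodic function gains a difference of the weight. -/
theorem average_pdd_representation {ρ w : (Fin d → ℝ) → ℝ} (hρ : ContDiff ℝ (⊤ : ℕ∞) ρ)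
    (hρ0 : ∀ y, 2 < ‖y‖ → ρ y = 0) (hw : ContDiff ℝ (⊤ : ℕ∞) w) (hwp : ZPer d w) (i : Fin d)
    {T : ℝ} (hT : 1 ≤ T) (x : Fin d → ℝ) :
    ∫ y, ρ y * pdd d i w (x - T • y) =
      ∫ q, (ρ q.2 - ρ (q.2 - (q.1 / T) • Pi.single i 1)) * pdd d i w (x - T • q.2)
        ∂(cylMeasure d 1) := by
  have hT0 : 0 < T := by linarith
  have hv : Continuous (pdd d i w) := (hw.pdd i).continuous
  have hρc := hρ.continuous
  have hΦ : Continuous fun q : ℝ × (Fin d → ℝ) =>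
      (ρ q.2 - ρ (q.2 - (q.1 / T) • Pi.single i 1)) * pdd d i w (x - T • q.2) := by
    fun_prop
  have hΨ : Continuous fun q : ℝ × (Fin d → ℝ) =>
      ρ q.2 * pdd d i w (x - T • q.2) -
        ρ q.2 * pdd d i w (x - T • q.2 - q.1 • Pi.single i 1) := by
    fun_prop
  have hcs := hasCompactSupport_of_norm_lt hρ0
  rw [integral_cylMeasure hΦ 1]
  · have h1 : ∀ t : ℝ,
        ∫ y, (ρ y - ρ (y - (t / T) • Pi.single i 1)) * pdd d i w (x - T • y) =
        ∫ y, (ρ y * pdd d i w (x - T • y) -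
          ρ y * pdd d i w (x - T • y - t • Pi.single i 1)) := by
      intro t
      have hi : ∀ {G : (Fin d → ℝ) → ℝ}, Continuous G → Integrable fun y => ρ y * G y :=
        fun hG => (hρc.mul hG).integrable_of_hasCompactSupport hcs.mul_right
      have hi2 : Integrable fun y => ρ y * pdd d i w (x - T • y - t • Pi.single i 1) :=
        hi (by fun_prop)
      have hshift : ∀ y : Fin d → ℝ,
          ρ (y - (t / T) • Pi.single i 1) * pdd d i w (x - T • y) =
          (fun y => ρ y * pdd d i w (x - T • y - t • Pi.single i 1))
            (y - (t / T) • Pi.single i 1) := by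
        intro y
        have : x - T • (y - (t / T) • (Pi.single i 1 : Fin d → ℝ)) - t • Pi.single i 1 =
            x - T • y := by
          rw [smul_sub, smul_smul, mul_div_cancel₀ t hT0.ne']
          abel
        simp only [this]
      rw [integral_sub (hi (by fun_prop)) hi2]
      simp only [sub_mul]
      rw [integral_sub (hi (by fun_prop))]
      · simp only [hshift]
        exact congrArg _ (integral_sub_right_eq_self (μ := volume)
          (fun y => ρ y * pdd d i w (x - T • y - t • Pi.single i 1)) _)
      · simp only [hshift]
        exact hi2.comp_sub_right _
    simp only [h1]
    rw [← integral_cylMeasure hΨ 1 fun s _ y hy => by simp [hρ0 y (by linarith)],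
      integral_cylMeasure_symm hΨ 1 fun s _ y hy => by simp [hρ0 y (by linarith)]]
    congr 1
    funext y
    have hvy : Continuous fun t : ℝ => pdd d i w (x - T • y - t • Pi.single i 1) := by fun_prop
    have h2 : ∫ t in Set.Icc (0 : ℝ) 1, pdd d i w (x - T • y - t • Pi.single i 1) = 0 := by
      have h := sub_comp_smul_eq_integral hw (x - T • y) (Pi.single i 1) 1
      have hp := hwp (x - T • y - (1 : ℝ) • Pi.single i 1) (Pi.single i 1)
      have he : (fun l => (((Pi.single i 1 : Fin d → ℤ) l : ℤ) : ℝ)) = Pi.single i 1 := by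
        funext l
        by_cases hl : l = i
        · subst hl; simp
        · simp [hl]
      rw [he, one_smul, sub_add_cancel] at hp
      rw [one_smul, hp, sub_self] at h
      simp only [Pi.single_apply, ite_mul, one_mul, zero_mul, Finset.sum_ite_eq',
        Finset.mem_univ, if_true] at h
      rw [integral_Icc_eq_integral_Ioc, ← intervalIntegral.integral_of_le zero_le_one, ← h]
    change _ = ∫ t in Set.Icc (0 : ℝ) 1, (ρ y * pdd d i w (x - T • y) -
      ρ y * pdd d i w (x - T • y - t • Pi.single i 1))
    rw [integral_sub (integrable_const _) (hvy.integrableOn_Icc.const_mul _), integral_const_mul,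
      integral_const_mul,
      h2]
    simp
  · intro t ht y hy
    have h3 : 2 < ‖y - (t / T) • (Pi.single i 1 : Fin d → ℝ)‖ := by
      have hn : ‖(t / T) • (Pi.single i 1 : Fin d → ℝ)‖ ≤ 1 := by
        rw [norm_smul, Pi.norm_single, norm_one, mul_one, Real.norm_of_nonneg
          (div_nonneg ht.1 hT0.le)]
        exact (div_le_one hT0).2 (ht.2.trans hT)
      have := norm_sub_norm_le y ((t / T) • (Pi.single i 1 : Fin d → ℝ))
      linarith
    simp [hρ0 y (by linarith), hρ0 _ h3]

end Representation

section Estimate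

variable {d : ℕ}

theorem stronglyMeasurable_integral_mul_translate {Y : Type*} [MeasurableSpace Y]
    {μ : Measure Y} [SFinite μ] {a : Y → ℝ} {v : (Fin d → ℝ) → ℝ} {τ : Y → Fin d → ℝ}
    (ha : Measurable a) (hv : Measurable v) (hτ : Measurable τ) :
    StronglyMeasurable fun x => ∫ y, a y * v (x - τ y) ∂μ := by
  refine StronglyMeasurable.integral_prod_right (f := fun x y => a y * v (x - τ y)) ?_
  exact ((ha.comp measurable_snd).mul
    (hv.comp (measurable_fst.sub (hτ.comp measurable_snd)))).stronglyMeasurable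

theorem lpNorm_ne_top_of_continuous {v : (Fin d → ℝ) → ℝ} (hv : Continuous v) (p : ℝ≥0∞) :
    lpNorm d p v ≠ ⊤ := by
  obtain ⟨C, hC⟩ := (isCompact_Icc (a := (0 : Fin d → ℝ)) (b := 1)).exists_bound_of_continuousOn
    hv.continuousOn
  have : IsFiniteMeasure ((volume : Measure (Fin d → ℝ)).restrict (Set.Icc 0 1)) :=
    ⟨by rw [Measure.restrict_apply_univ]; exact isCompact_Icc.measure_lt_top⟩
  exact (MemLp.of_bound hv.aestronglyMeasurable C
    ((ae_restrict_iff' measurableSet_Icc).2 (Filter.Eventually.of_forall hC))).eLpNorm_ne_top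

theorem lpNorm_const_mul (c : ℝ) (v : (Fin d → ℝ) → ℝ) (p : ℝ≥0∞) :
    lpNorm d p (fun x => c * v x) = ‖c‖ₑ * lpNorm d p v :=
  eLpNorm_const_smul c v p _

/-- Shifting the weight of an average along a periodic direction: the average of a derivative
over the scale `T` is `O(1 / T)`. -/
theorem lpNorm_average_pdd_le {ρ w : (Fin d → ℝ) → ℝ} (hρ : ContDiff ℝ (⊤ : ℕ∞) ρ)
    (hρ0 : ∀ y, 2 < ‖y‖ → ρ y = 0) {L : ℝ≥0} (hL : LipschitzWith L ρ)
    (hw : ContDiff ℝ (⊤ : ℕ∞) w) (hwp : ZPer d w) (i : Fin d) {T : ℝ≥0} (hT : 1 ≤ T)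
    {p : ℝ≥0∞} (hp : 1 ≤ p) :
    lpNorm d p (fun x => ∫ y, ρ y * pdd d i w (x - (T : ℝ) • y)) ≤
      (L / T : ℝ≥0) * cylMeasure d 1 Set.univ * lpNorm d p (pdd d i w) := by
  have hT0 : (0 : ℝ) < T := by exact_mod_cast one_pos.trans_le hT
  have hM : ∀ᵐ q ∂(cylMeasure d 1),
      ‖ρ q.2 - ρ (q.2 - (q.1 / (T : ℝ)) • Pi.single i 1)‖ₑ ≤ (L / T : ℝ≥0) := by
    have h1 : ∀ᵐ q ∂(cylMeasure d 1), q ∈ Set.Icc (0 : ℝ) 1 ×ˢ Metric.closedBall 0 3 := by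
      rw [cylMeasure, Measure.prod_restrict]
      exact ae_restrict_mem (measurableSet_Icc.prod measurableSet_closedBall)
    filter_upwards [h1] with q hq
    rw [enorm_le_coe, ← NNReal.coe_le_coe, coe_nnnorm, ← dist_eq_norm]
    refine (hL.dist_le_mul _ _).trans ?_
    rw [dist_eq_norm, sub_sub_cancel, norm_smul, Pi.norm_single, norm_one, mul_one,
      Real.norm_of_nonneg (div_nonneg hq.1.1 hT0.le), NNReal.coe_div, div_eq_mul_one_div (L : ℝ)]
    have := hq.1.2
    gcongr
  have hT1 : (1 : ℝ) ≤ T := by exact_mod_cast hT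
  rw [funext fun x => average_pdd_representation hρ hρ0 hw hwp i hT1 x]
  have hτ : Measurable fun q : ℝ × (Fin d → ℝ) => (T : ℝ) • q.2 := by fun_prop
  exact (hwp.pdd hw i).lpNorm_integral_le (hw.pdd i).continuous.measurable hp _ hτ hM

theorem exists_lpNorm_third_derivative_le_aux (i j m : Fin d) {p : ℝ≥0∞} (hp : 1 ≤ p) :
    ∃ C : ℝ≥0, ∀ u : (Fin d → ℝ) → ℝ, ContDiff ℝ (⊤ : ℕ∞) u → ZPer d (pdd d j (pdd d m u)) →
      ZPer d (lap d (lap d u)) →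
      lpNorm d p (pdd d i (pdd d j (pdd d m u))) ≤ C * lpNorm d p (lap d (lap d u)) := by
  obtain ⟨k, ρ, hk, hρ, hk0, hρ0, hkρ, hc⟩ := exists_biharmonic_kernel d
  set c := ∫ y, ρ y
  obtain ⟨L, hL⟩ := hρ.lipschitzWith_of_hasCompactSupport (hasCompactSupport_of_norm_lt hρ0)
    (by simp)
  have hK := ((hk.pdd i).pdd j).pdd m
  obtain ⟨M, hM⟩ := (hasCompactSupport_of_norm_lt (pdd_eq_zero_of_norm_lt
    (pdd_eq_zero_of_norm_lt (pdd_eq_zero_of_norm_lt hk0 i) j) m)).exists_bound_of_continuous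
    hK.continuous
  lift cylMeasure d 1 Set.univ to ℝ≥0 using measure_ne_top _ _ with V hV
  lift c to ℝ≥0 using hc.le with c' hc'
  have hc0 : 0 < c' := by exact_mod_cast hc
  set T : ℝ≥0 := max 1 (2 * L * V / c') with hTdef
  have hT : 1 ≤ T := le_max_left _ _
  have hT0 : 0 < T := one_pos.trans_le hT
  have hLT : L / T * V ≤ c' / 2 := by
    have h1 : 2 * L * V ≤ T * c' := (div_le_iff₀ hc0).1 (le_max_right _ _)
    rw [div_mul_eq_mul_div, div_le_iff₀ hT0]
    rw [← NNReal.coe_le_coe] at h1 ⊢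
    push_cast at h1 ⊢
    linarith
  lift cylMeasure d T Set.univ to ℝ≥0 using measure_ne_top _ _ with W hW
  refine ⟨2 * (M.toNNReal * W) / c', fun u hu hwp hgp => ?_⟩
  have hw := (hu.pdd m).pdd j
  have hg := hu.lap.lap
  set g := lap d (lap d u)
  set v := pdd d i (pdd d j (pdd d m u)) with hvdef
  have hrep : (fun x => (c' : ℝ) * v x) = fun x => (∫ y, ρ y * v (x - (T : ℝ) • y)) +
      ∫ q, pdd d m (pdd d j (pdd d i k)) q.2 * g (x - q.1 • q.2) ∂(cylMeasure d T) := by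
    funext x
    rw [hc']
    exact third_derivative_representation hk hρ hk0 hρ0 hkρ hu i j m T.2 x
  have h1 : lpNorm d p (fun x => (c' : ℝ) * v x) ≤
      (L / T : ℝ≥0) * V * lpNorm d p v + M.toNNReal * W * lpNorm d p g := by
    rw [hrep]
    refine (eLpNorm_add_le ?_ ?_ hp).trans (add_le_add ?_ ?_)
    · exact (stronglyMeasurable_integral_mul_translate (τ := fun y => (T : ℝ) • y)
        hρ.continuous.measurable (hw.pdd i).continuous.measurable (by fun_prop)).aestronglyMeasurable
    · exact (stronglyMeasurable_integral_mul_translate (hK.continuous.measurable.comp measurable_snd)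
        hg.continuous.measurable (measurable_fst.smul measurable_snd)).aestronglyMeasurable
    · rw [hV]
      exact lpNorm_average_pdd_le hρ hρ0 hL hw hwp i hT hp
    · rw [hW]
      refine hgp.lpNorm_integral_le hg.continuous.measurable hp _
        (measurable_fst.smul measurable_snd) (Filter.Eventually.of_forall fun q => ?_)
      rw [enorm_le_coe, ← NNReal.coe_le_coe, coe_nnnorm]
      exact (hM _).trans (Real.le_coe_toNNReal M)
  rw [lpNorm_const_mul] at h1
  lift lpNorm d p v to ℝ≥0 using lpNorm_ne_top_of_continuous (hw.pdd i).continuous p with N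
  lift lpNorm d p g to ℝ≥0 using lpNorm_ne_top_of_continuous hg.continuous p with G
  have h2 : c' * N ≤ L / T * V * N + M.toNNReal * W * G := by
    have : ‖(c' : ℝ)‖ₑ = (c' : ℝ≥0∞) := by simp [enorm]
    rw [this] at h1
    exact_mod_cast h1
  have h3 : L / T * V * N ≤ c' / 2 * N := mul_le_mul_left hLT N
  have h4 : N ≤ 2 * (M.toNNReal * W) / c' * G := by
    rw [div_mul_eq_mul_div, le_div_iff₀ hc0]
    have h5 := h2.trans (add_le_add_left h3 _)
    rw [← NNReal.coe_le_coe] at h5 ⊢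
    push_cast at h5 ⊢
    linarith
  exact_mod_cast h4

/-- Third derivatives are controlled by the bilaplacian in `L^p`, endpoints included. -/
theorem exists_lpNorm_third_derivative_le (d : ℕ) {p : ℝ≥0∞} (hp : 1 ≤ p) :
    ∃ C : ℝ≥0, ∀ (i j m : Fin d) (u : (Fin d → ℝ) → ℝ), ContDiff ℝ (⊤ : ℕ∞) u →
      ZPer d (pdd d j (pdd d m u)) → ZPer d (lap d (lap d u)) →
      lpNorm d p (pdd d i (pdd d j (pdd d m u))) ≤ C * lpNorm d p (lap d (lap d u)) := by
  choose C hC using fun q : Fin d × Fin d × Fin d =>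
    exists_lpNorm_third_derivative_le_aux q.1 q.2.1 q.2.2 hp
  refine ⟨∑ q, C q, fun i j m u hu hw hg => (hC (i, j, m) u hu hw hg).trans ?_⟩
  gcongr
  exact Finset.single_le_sum (f := C) (fun _ _ => zero_le) (Finset.mem_univ _)

end Estimate

section Scaling

variable {d : ℕ} {h F : (Fin d → ℝ) → ℝ}

theorem zPer_of_periodic_single (hh : ∀ r, Function.Periodic h (Pi.single r 1)) : ZPer d h := by
  intro x n
  have key : ∀ s : Finset (Fin d), Function.Periodic h (∑ r ∈ s, n r • Pi.single r (1 : ℝ)) := by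
    intro s
    induction s using Finset.induction_on with
    | empty => simp [Function.Periodic]
    | insert a s ha ih =>
      rw [Finset.sum_insert ha]
      exact ((hh a).zsmul (n a)).add_period ih
  have he : (fun i => (n i : ℝ)) = ∑ r, n r • Pi.single r (1 : ℝ) := by
    rw [← Finset.univ_sum_single fun i => (n i : ℝ)]
    refine Finset.sum_congr rfl fun r _ => ?_
    rw [← Pi.single_smul]
    simp
  rw [he]
  exact key _ x

theorem ZPer.periodic_single (hh : ZPer d h) (r : Fin d) :
    Function.Periodic h (Pi.single r 1) := by
  intro x
  rw [← hh x (Pi.single r 1)]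
  congr 2
  funext l
  by_cases hl : l = r
  · subst hl; simp
  · simp [hl]

theorem ZPer.eq_zero_of_lpNorm_eq_zero (hh : ZPer d h) (hc : Continuous h) {p : ℝ≥0∞}
    (hp : 1 ≤ p) (h0 : lpNorm d p h = 0) : h = 0 := by
  have hae := (eLpNorm_eq_zero_iff hc.aestronglyMeasurable (zero_lt_one.trans_le hp).ne').1 h0
  have hcl : Set.Icc (0 : Fin d → ℝ) 1 ⊆ closure (interior (Set.Icc 0 1)) := by
    rw [(convex_Icc (𝕜 := ℝ) _ _).closure_interior_eq_closure_of_nonempty_interior]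
    · exact subset_closure
    · rw [← Set.pi_univ_Icc, interior_pi_set Set.finite_univ]
      exact ⟨fun _ => 1 / 2, fun i _ => by simp [interior_Icc]; norm_num⟩
  have heq := Measure.eqOn_of_ae_eq hae hc.continuousOn continuousOn_const hcl
  funext x
  have hx : x = (fun i => Int.fract (x i)) + fun i => (⌊x i⌋ : ℝ) :=
    funext fun i => (Int.fract_add_floor (x i)).symm
  rw [hx, hh]
  exact heq ⟨fun i => Int.fract_nonneg _, fun i => (Int.fract_lt_one _).le⟩

theorem eq_of_forall_pdd_eq_zero (hh : ContDiff ℝ (⊤ : ℕ∞) h) (h0 : ∀ i, pdd d i h = 0)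
    (x y : Fin d → ℝ) : h x = h y := by
  refine is_const_of_fderiv_eq_zero (𝕜 := ℝ) (fun z => hh.differentiableAt_of_smooth z)
    (fun z => ?_) x y
  ext y
  rw [apply_eq_sum_mul_single]
  exact Finset.sum_eq_zero fun l _ => by
    rw [show fderiv ℝ h z (Pi.single l 1) = 0 from congrFun (h0 l) z, mul_zero]

theorem pdd_const_mul_comp_smul (hh : ContDiff ℝ (⊤ : ℕ∞) h) (a c : ℝ) (i : Fin d) :
    pdd d i (fun y => a * h (c • y)) = fun y => (a * c) * pdd d i h (c • y) := by
  have hc : ContDiff ℝ (⊤ : ℕ∞) fun y => h (c • y) := hh.comp (contDiff_const_smul c)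
  rw [pdd_const_mul hc, pdd_comp_smul hh]
  simp only [mul_assoc]

theorem lap_const_mul_comp_smul (hh : ContDiff ℝ (⊤ : ℕ∞) h) (a c : ℝ) :
    lap d (fun y => a * h (c • y)) = fun y => (a * c ^ 2) * lap d h (c • y) := by
  have hc : ContDiff ℝ (⊤ : ℕ∞) fun y => h (c • y) := hh.comp (contDiff_const_smul c)
  rw [lap_const_mul hc, lap_comp_smul hh]
  simp only [mul_assoc]

/-- A periodic solution of `Δ² χ = F(σ ·)` has `1 / σ`-periodic second derivatives. -/
theorem periodic_pdd_pdd_of_lap_lap {χ : (Fin d → ℝ) → ℝ} (hχ : ContDiff ℝ (⊤ : ℕ∞) χ)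
    (hχp : ZPer d χ) (hF : ZPer d F) {σ : ℕ} (hσ : 0 < σ)
    (hχF : ∀ x, lap d (lap d χ) x = F ((σ : ℝ) • x)) (j m r : Fin d) :
    Function.Periodic (pdd d j (pdd d m χ)) ((σ : ℝ)⁻¹ • Pi.single r 1) := by
  set z : Fin d → ℝ := (σ : ℝ)⁻¹ • Pi.single r 1 with hz
  have hσ0 : (σ : ℝ) ≠ 0 := by exact_mod_cast hσ.ne'
  have hσz : (σ : ℝ) • z = Pi.single r 1 := smul_inv_smul₀ hσ0 _
  have hshift : ∀ {g : (Fin d → ℝ) → ℝ}, ContDiff ℝ (⊤ : ℕ∞) g →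
      ContDiff ℝ (⊤ : ℕ∞) fun y => g (y + z) :=
    fun hg => hg.comp (contDiff_id.add contDiff_const)
  have hχz := hshift hχ
  set w : (Fin d → ℝ) → ℝ := fun y => χ (y + z) - χ y with hwdef
  have hw : ContDiff ℝ (⊤ : ℕ∞) w := hχz.sub hχ
  have hwp : ZPer d w := fun x n => by
    simp only [hwdef]
    rw [add_right_comm, hχp, hχp]
  have hwl : lap d (lap d w) = 0 := by
    rw [hwdef, lap_sub hχz hχ, lap_comp_add hχ,
      lap_sub (hshift hχ.lap) hχ.lap, lap_comp_add hχ.lap]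
    funext x
    beta_reduce
    rw [hχF, hχF, smul_add, hσz, hF.periodic_single, sub_self]
    rfl
  have hwh : pdd d j (pdd d m w) = fun y => pdd d j (pdd d m χ) (y + z) -
      pdd d j (pdd d m χ) y := by
    rw [hwdef, pdd_sub hχz hχ, pdd_comp_add hχ,
      pdd_sub (hshift (hχ.pdd m)) (hχ.pdd m),
      pdd_comp_add (hχ.pdd m)]
  have hws := (hw.pdd m).pdd j
  have hwsp := (hwp.pdd hw m).pdd (hw.pdd m) j
  have hconst := eq_of_forall_pdd_eq_zero hws fun i => by
    obtain ⟨C, hC⟩ := exists_lpNorm_third_derivative_le d (le_refl (1 : ℝ≥0∞))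
    refine (hwsp.pdd hws i).eq_zero_of_lpNorm_eq_zero (hws.pdd i).continuous le_rfl ?_
    have h1 := hC i j m w hw hwsp ((hwp.lap hw).lap hw.lap)
    rw [hwl, show lpNorm d 1 (0 : (Fin d → ℝ) → ℝ) = 0 from eLpNorm_zero, mul_zero] at h1
    exact le_antisymm h1 zero_le
  set c := pdd d j (pdd d m w) 0
  have hstep : ∀ x, pdd d j (pdd d m χ) (x + z) = pdd d j (pdd d m χ) x + c := fun x => by
    have := congrFun hwh x
    rw [hconst x 0] at this
    linarith
  have hiter : ∀ (n : ℕ) x, pdd d j (pdd d m χ) (x + (n : ℝ) • z) =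
      pdd d j (pdd d m χ) x + n * c := by
    intro n
    induction n with
    | zero => simp
    | succ n ih =>
      intro x
      push_cast
      rw [add_smul, one_smul, ← add_assoc, hstep, ih]
      ring
  have hc : c = 0 := by
    have h1 := hiter σ 0
    rw [hσz, ((hχp.pdd hχ m).pdd (hχ.pdd m) j).periodic_single] at h1
    have h2 : (σ : ℝ) * c = 0 := by linarith
    exact (mul_eq_zero.1 h2).resolve_left hσ0
  intro x
  rw [hstep, hc, add_zero]

/-- Third derivatives of the periodic solution of `Δ² χ = F(σ ·)` gain a factor `1 / σ`. -/
theorem lpNorm_third_derivative_le_of_scaling {p : ℝ≥0∞} {C : ℝ≥0}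
    (hC : ∀ (i j m : Fin d) (u : (Fin d → ℝ) → ℝ), ContDiff ℝ (⊤ : ℕ∞) u →
      ZPer d (pdd d j (pdd d m u)) → ZPer d (lap d (lap d u)) →
      lpNorm d p (pdd d i (pdd d j (pdd d m u))) ≤ C * lpNorm d p (lap d (lap d u)))
    {χ : (Fin d → ℝ) → ℝ} (hχ : ContDiff ℝ (⊤ : ℕ∞) χ)
    (hχp : ZPer d χ) (hF : ZPer d F) {σ : ℕ} (hσ : 0 < σ)
    (hχF : ∀ x, lap d (lap d χ) x = F ((σ : ℝ) • x)) (i j m : Fin d) :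
    lpNorm d p (pdd d i (pdd d j (pdd d m χ))) ≤ C * (σ : ℝ≥0∞)⁻¹ * lpNorm d p F := by
  have hσ0 : (σ : ℝ) ≠ 0 := by exact_mod_cast hσ.ne'
  set τ : ℝ := (σ : ℝ)⁻¹ with hτ
  set U : (Fin d → ℝ) → ℝ := fun y => (σ : ℝ) ^ 3 * χ (τ • y) with hUdef
  have hU : ContDiff ℝ (⊤ : ℕ∞) U := contDiff_const.mul (hχ.comp (contDiff_const_smul τ))
  have hU2 : pdd d j (pdd d m U) = fun y => ((σ : ℝ) ^ 3 * τ * τ) * pdd d j (pdd d m χ) (τ • y) := by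
    rw [hUdef, pdd_const_mul_comp_smul hχ, pdd_const_mul_comp_smul (hχ.pdd m)]
  have hU3 : pdd d i (pdd d j (pdd d m U)) = fun y => pdd d i (pdd d j (pdd d m χ)) (τ • y) := by
    rw [hU2, pdd_const_mul_comp_smul ((hχ.pdd m).pdd j)]
    funext y
    rw [show (σ : ℝ) ^ 3 * τ * τ * τ = 1 by rw [hτ]; field_simp, one_mul]
  have hUl : lap d (lap d U) = fun y => τ * F y := by
    rw [hUdef, lap_const_mul_comp_smul hχ, lap_const_mul_comp_smul hχ.lap]
    funext y
    rw [hχF, smul_inv_smul₀ hσ0]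
    congr 1
    rw [hτ]
    field_simp
  have hUp : ZPer d (pdd d j (pdd d m U)) := by
    refine zPer_of_periodic_single fun r x => ?_
    rw [hU2]
    simp only [smul_add]
    rw [periodic_pdd_pdd_of_lap_lap hχ hχp hF hσ hχF]
  have hmain := hC i j m U hU hUp fun x n => by rw [hUl]; simp only [hF x n]
  have hU2s := (hU.pdd m).pdd j
  rw [← (hUp.pdd hU2s i).lpNorm_comp (hU2s.pdd i).continuous.measurable p hσ 0, hU3, hUl,
    lpNorm_const_mul] at hmain
  have he : ‖τ‖ₑ = (σ : ℝ≥0∞)⁻¹ := by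
    rw [hτ, enorm_inv hσ0, Real.enorm_natCast]
  simp only [add_zero, hτ, inv_smul_smul₀ hσ0] at hmain
  rw [mul_assoc, ← he]
  exact hmain

theorem norm_invDivMatrix_le {φ χ : (Fin d → ℝ) → (Fin d → ℝ)} (hχ : ContDiff ℝ (⊤ : ℕ∞) χ)
    (hφχ : ∀ x k, lap d (fun y => χ y k) x = φ x k) (x : Fin d → ℝ) :
    ‖invDivMatrix d φ χ x‖ ≤
      (|(2 - (d : ℝ)) / ((d : ℝ) - 1)| * d + |1 / ((d : ℝ) - 1)| * (d * d) + d + d) *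
      ∑ q : Fin d × Fin d × Fin d × Fin d,
        ‖pdd d q.2.1 (pdd d q.2.2.1 (pdd d q.2.2.2 fun y => χ y q.1)) x‖ := by
  have hχl : ∀ l, ContDiff ℝ (⊤ : ℕ∞) fun y => χ y l := fun l => contDiff_pi.1 hχ l
  set S := ∑ q : Fin d × Fin d × Fin d × Fin d,
    ‖pdd d q.2.1 (pdd d q.2.2.1 (pdd d q.2.2.2 fun y => χ y q.1)) x‖ with hS
  have hS0 : 0 ≤ S := Finset.sum_nonneg fun _ _ => norm_nonneg _
  have hA : ∀ l i j k, |pdd d i (pdd d j (pdd d k fun y => χ y l)) x| ≤ S := fun l i j k =>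
    Finset.single_le_sum (f := fun q : Fin d × Fin d × Fin d × Fin d =>
      ‖pdd d q.2.1 (pdd d q.2.2.1 (pdd d q.2.2.2 fun y => χ y q.1)) x‖)
      (fun _ _ => norm_nonneg _) (Finset.mem_univ (l, i, j, k))
  have hsum : ∀ {g : Fin d → ℝ} {B : ℝ}, (∀ k, |g k| ≤ B) → |∑ k, g k| ≤ d * B := by
    intro g B hg
    refine (Finset.abs_sum_le_sum_abs _ _).trans ((Finset.sum_le_sum fun k _ => hg k).trans ?_)
    simp
  have hφ : ∀ k l, |pdd d k (fun y => φ y l) x| ≤ d * S := by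
    intro k l
    have h1 : (fun y => φ y l) = lap d fun y => χ y l := funext fun y => (hφχ y l).symm
    have h2 : pdd d k (lap d fun y => χ y l) =
        fun y => ∑ r, pdd d k (pdd d r (pdd d r fun y => χ y l)) y :=
      pdd_sum _ (fun r => ((hχl l).pdd r).pdd r) k
    rw [h1, h2]
    exact hsum fun r => hA l k r r
  refine (pi_norm_le_iff_of_nonneg (by positivity)).2 fun i =>
    (pi_norm_le_iff_of_nonneg (by positivity)).2 fun j => ?_
  have h1 : |∑ k, pdd d i (pdd d j (pdd d k fun y => χ y k)) x| ≤ d * S :=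
    hsum fun k => hA k i j k
  have h2 : |if i = j then ∑ k, pdd d k (fun y => φ y k) x else 0| ≤ d * (d * S) := by
    split_ifs
    · exact hsum fun k => hφ k k
    · rw [abs_zero]; positivity
  rw [Real.norm_eq_abs]
  calc |invDivMatrix d φ χ x i j|
      ≤ |(2 - (d : ℝ)) / ((d : ℝ) - 1)| * (d * S) + |1 / ((d : ℝ) - 1)| * (d * (d * S)) +
        d * S + d * S := by
        refine (abs_add_le _ _).trans (add_le_add ((abs_add_le _ _).trans
          (add_le_add ((abs_sub _ _).trans (add_le_add ?_ ?_)) (hφ i j))) (hφ j i))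
        · rw [abs_mul]
          exact mul_le_mul_of_nonneg_left h1 (abs_nonneg _)
        · rw [abs_mul]
          exact mul_le_mul_of_nonneg_left h2 (abs_nonneg _)
    _ = _ := by ring

end Scaling

/-- **Scaling property of the inverse divergence.**  Let `1 ≤ p ≤ ∞`.  There is a
constant `C` (independent of `σ`) such that for every smooth mean-zero periodic
`f : 𝕋^d → ℝ^d`, every `σ ∈ ℕ`, and the potentials `φ = Δ⁻¹(f(σ·))`, `χ = Δ⁻²(f(σ·))`
(smooth, periodic, mean-zero), one has `‖R(f(σ·))‖_{L^p} ≤ C σ⁻¹ ‖f‖_{L^p}`. -/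
theorem inverse_divergence_scaling (d : ℕ) (hd : 2 ≤ d) (p : ℝ≥0∞) (hp : 1 ≤ p) :
    ∃ C : ℝ≥0∞, 0 < C ∧ C < ⊤ ∧
      ∀ (f : (Fin d → ℝ) → (Fin d → ℝ)), ContDiff ℝ (⊤ : ℕ∞) f → ZPerV d f →
        (∀ k, ∫ x in Set.Icc (0 : Fin d → ℝ) 1, f x k = 0) →
        ∀ σ : ℕ, 0 < σ →
        ∀ (φ χ : (Fin d → ℝ) → (Fin d → ℝ)),
          ContDiff ℝ (⊤ : ℕ∞) φ → ContDiff ℝ (⊤ : ℕ∞) χ → ZPerV d φ → ZPerV d χ →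
          (∀ k, ∫ x in Set.Icc (0 : Fin d → ℝ) 1, φ x k = 0) →
          (∀ k, ∫ x in Set.Icc (0 : Fin d → ℝ) 1, χ x k = 0) →
          (∀ x k, lap d (fun y => φ y k) x = f ((σ : ℝ) • x) k) →
          (∀ x k, lap d (fun y => χ y k) x = φ x k) →
          lpNorm d p (fun x => invDivMatrix d φ χ x)
            ≤ C * ((σ : ℝ≥0∞))⁻¹ * lpNorm d p f := by
  obtain ⟨C, hC⟩ := exists_lpNorm_third_derivative_le d hp
  set K : ℝ := |(2 - (d : ℝ)) / ((d : ℝ) - 1)| * d + |1 / ((d : ℝ) - 1)| * (d * d) + d + d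
    with hK
  refine ⟨‖K‖ₑ * (Fintype.card (Fin d × Fin d × Fin d × Fin d) * C) + 1, by simp,
    by simp [lt_top_iff_ne_top, ENNReal.mul_eq_top], ?_⟩
  intro f _ hfp _ σ hσ φ χ _ hχ _ hχp _ _ hφf hχφ
  set G : (Fin d → ℝ) → ℝ := fun x => ∑ q : Fin d × Fin d × Fin d × Fin d,
    ‖pdd d q.2.1 (pdd d q.2.2.1 (pdd d q.2.2.2 fun y => χ y q.1)) x‖ with hG
  have hχl : ∀ l, ContDiff ℝ (⊤ : ℕ∞) fun y => χ y l := fun l => contDiff_pi.1 hχ l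
  have hterm : ∀ q : Fin d × Fin d × Fin d × Fin d,
      lpNorm d p (pdd d q.2.1 (pdd d q.2.2.1 (pdd d q.2.2.2 fun y => χ y q.1))) ≤
        C * (σ : ℝ≥0∞)⁻¹ * lpNorm d p f := by
    rintro ⟨l, i, j, m⟩
    have h1 : ∀ x, lap d (lap d fun y => χ y l) x = f ((σ : ℝ) • x) l := fun x => by
      rw [show (lap d fun y => χ y l) = fun y => φ y l from funext fun y => hχφ y l]
      exact hφf x l
    refine (lpNorm_third_derivative_le_of_scaling (F := fun x => f x l) hC (hχl l)
      (fun x n => congrFun (hχp x n) l) (fun x n => congrFun (hfp x n) l) hσ h1 i j m).trans ?_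
    gcongr
    exact eLpNorm_mono fun x => norm_le_pi_norm (f x) l
  have hGle : lpNorm d p G ≤ Fintype.card (Fin d × Fin d × Fin d × Fin d) *
      (C * (σ : ℝ≥0∞)⁻¹ * lpNorm d p f) := by
    have h1 : G = ∑ q : Fin d × Fin d × Fin d × Fin d, fun x =>
        ‖pdd d q.2.1 (pdd d q.2.2.1 (pdd d q.2.2.2 fun y => χ y q.1)) x‖ := by
      funext x
      simp [hG]
    rw [h1]
    refine (eLpNorm_sum_le (fun q _ => ?_) hp).trans ((Finset.sum_le_sum fun q _ => ?_).trans_eq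
      (by rw [Finset.sum_const, nsmul_eq_mul, Finset.card_univ]))
    · exact ((((hχl q.1).pdd _).pdd _).pdd _).continuous.norm.aestronglyMeasurable
    · rw [eLpNorm_norm]
      exact hterm q
  calc lpNorm d p (fun x => invDivMatrix d φ χ x)
      ≤ lpNorm d p fun x => K * G x :=
        eLpNorm_mono_real fun x => norm_invDivMatrix_le hχ hχφ x
    _ = ‖K‖ₑ * lpNorm d p G := lpNorm_const_mul K G p
    _ ≤ ‖K‖ₑ * (Fintype.card (Fin d × Fin d × Fin d × Fin d) *
        (C * (σ : ℝ≥0∞)⁻¹ * lpNorm d p f)) := by gcongr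
    _ = ‖K‖ₑ * (Fintype.card (Fin d × Fin d × Fin d × Fin d) * C) * (σ : ℝ≥0∞)⁻¹ *
        lpNorm d p f := by ring
    _ ≤ _ := by
        gcongr
        exact le_self_add
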